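/- (Gaussian integration by parts for the remainder.) Let Λ = (ℤ/Lℤ)^d for any d ≥ 1, let E ∈ I = {E : η < |E| ≤ 1.8}, and let 0 ∈ Λ denote the origin. Then ∫ dμ_B(a,b) R(a,b) a₀ = Σ_{l₀ ∈ Λ} B_{0 l₀} ∫ dμ_B(a,b) ∂_{a_{l₀}} R(a,b), where ∂_{a_{l₀}} denotes the partial derivative of R with respect to the variable a_{l₀} and all integrals are absolutely convergent Lebesgue integrals over ℝ^Λ × ℝ^Λ. -/

import Mathlib

open MeasureTheory Matrix Filter Set ProbabilityTheory

noncomputable section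

/-- Sites of the `d`-dimensional discrete torus `Λ = (ℤ/Lℤ)^d`. -/
abbrev Site (d L : ℕ) := Fin d → ZMod L

/-- The negative discrete Laplacian `−Δ` with periodic boundary conditions, as a matrix:
`(x, −Δ x) = Σ_{i∼j} (x_i − x_j)²`. -/
def negLap (d L : ℕ) [NeZero L] : Matrix (Site d L) (Site d L) ℝ :=
  fun i j => (if i = j then (2 * d : ℝ) else 0)
    - ∑ k : Fin d, ((if j = Function.update i k (i k + 1) then (1 : ℝ) else 0)
        + (if j = Function.update i k (i k - 1) then (1 : ℝ) else 0))

/-- The bulk energy interval `I = {E : η < |E| ≤ 1.8}`. -/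
def bulkInterval (η : ℝ) : Set ℝ := {E | η < |E| ∧ |E| ≤ 1.8}

/-- `ℰ = E/2 − i√(1 − E²/4)`, the relevant saddle point. -/
def calE (E : ℝ) : ℂ := (E / 2 : ℝ) - Complex.I * (Real.sqrt (1 - E ^ 2 / 4) : ℝ)

/-- `B⁻¹ = −W²Δ + (1 − ℰ²)` as a complex matrix. -/
def BmatInv (d L : ℕ) [NeZero L] (W E : ℝ) : Matrix (Site d L) (Site d L) ℂ :=
  (W ^ 2 : ℂ) • (negLap d L).map Complex.ofReal + (1 - calE E ^ 2) • 1

/-- The complex covariance `B = (−W²Δ + (1 − ℰ²))⁻¹`. -/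
def Bmat (d L : ℕ) [NeZero L] (W E : ℝ) : Matrix (Site d L) (Site d L) ℂ := (BmatInv d L W E)⁻¹

/-- The density of the complex Gaussian "measure" `dμ_B(a,b)` with respect to the
Lebesgue measure on `ℝ^Λ × ℝ^Λ`:
`det[B⁻¹/(2π)] exp(−½((a, B⁻¹ a) + (b, B⁻¹ b)))`. -/
def gaussDensityB (d L : ℕ) [NeZero L] (W E : ℝ) (a b : Site d L → ℝ) : ℂ :=
  ((2 * (Real.pi : ℂ))⁻¹ • BmatInv d L W E).det *
    Complex.exp (-(1 / 2) *
      ((∑ i, ∑ j, BmatInv d L W E i j * ((a i * a j : ℝ) : ℂ))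
        + ∑ i, ∑ j, BmatInv d L W E i j * ((b i * b j : ℝ) : ℂ)))

/-- The diagonal matrix `D(a,b)` with entries
`D_j = ℰ² − 1/((conj ℰ − a_j)(conj ℰ − i b_j))`. -/
def Dmat (d L : ℕ) [NeZero L] (E : ℝ) (a b : Site d L → ℝ) : Matrix (Site d L) (Site d L) ℂ :=
  Matrix.diagonal fun j =>
    calE E ^ 2 - 1 / (((starRingEnd ℂ) (calE E) - (a j : ℂ)) *
      ((starRingEnd ℂ) (calE E) - Complex.I * (b j : ℂ)))

/-- `V(x) = ∫₀¹ x³(1−t)²/(conj ℰ − t x)³ dt`. -/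
def Vpot (E : ℝ) (x : ℂ) : ℂ :=
  ∫ t in (0:ℝ)..1, x ^ 3 * ((1 - t : ℝ) : ℂ) ^ 2 / ((starRingEnd ℂ) (calE E) - (t : ℂ) * x) ^ 3

/-- The effective potential `𝒱(a,b) = Σ_j (V(a_j) − V(i b_j))`. -/
def calV (d L : ℕ) [NeZero L] (E : ℝ) (a b : Site d L → ℝ) : ℂ :=
  ∑ j, (Vpot E (a j) - Vpot E (Complex.I * (b j : ℂ)))

/-- The remainder `R(a,b) = det[1 + D(a,b)B] e^{𝒱(a,b)}`. -/
def Rfun (d L : ℕ) [NeZero L] (W E : ℝ) (a b : Site d L → ℝ) : ℂ :=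
  (1 + Dmat d L E a b * Bmat d L W E).det * Complex.exp (calV d L E a b)


lemma calE_re (E : ℝ) : (calE E).re = E / 2 := by simp [calE]

lemma calE_im (E : ℝ) : (calE E).im = -Real.sqrt (1 - E ^ 2 / 4) := by simp [calE]

lemma sqrt_pos_of_bulk {E : ℝ} (hE : |E| < 2) : 0 < Real.sqrt (1 - E ^ 2 / 4) := by
  apply Real.sqrt_pos.2
  have := abs_lt.1 hE
  nlinarith

lemma calE_mul_conj {E : ℝ} (hE : |E| < 2) : calE E * (starRingEnd ℂ) (calE E) = 1 := by
  rw [Complex.mul_conj, Complex.normSq_apply, calE_re, calE_im, neg_mul_neg,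
    Real.mul_self_sqrt (Real.sqrt_pos.1 (sqrt_pos_of_bulk hE)).le]
  norm_cast
  ring

lemma calE_ne_zero {E : ℝ} (hE : |E| < 2) : calE E ≠ 0 :=
  left_ne_zero_of_mul_eq_one (calE_mul_conj hE)

lemma conj_calE {E : ℝ} (hE : |E| < 2) : (starRingEnd ℂ) (calE E) = (calE E)⁻¹ :=
  eq_inv_of_mul_eq_one_right (calE_mul_conj hE)

lemma norm_calE {E : ℝ} (hE : |E| < 2) : ‖calE E‖ = 1 := by
  have h := congrArg norm (calE_mul_conj hE)
  rw [norm_mul, RCLike.norm_conj, norm_one] at h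
  nlinarith [norm_nonneg (calE E)]

/-- Taylor's formula with integral remainder for `-log (1 - y)`. -/
lemma integral_log_remainder (y : ℂ)
    (h : ∀ t ∈ Icc (0 : ℝ) 1, 1 - (t : ℂ) * y ∈ Complex.slitPlane) :
    ∫ t in (0 : ℝ)..1, y ^ 3 * ((1 - t : ℝ) : ℂ) ^ 2 / (1 - (t : ℂ) * y) ^ 3
      = -Complex.log (1 - y) - y - y ^ 2 / 2 := by
  have hne : ∀ t ∈ Icc (0 : ℝ) 1, 1 - (t : ℂ) * y ≠ 0 := fun t ht =>
    Complex.slitPlane_ne_zero (h t ht)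
  have hy : 1 - y ≠ 0 := by simpa using hne 1 (by simp)
  have key : ∀ t ∈ uIcc (0 : ℝ) 1, HasDerivAt (fun t : ℝ => -Complex.log (1 - (t : ℂ) * y)
      - 2 * (1 - y) * (1 - (t : ℂ) * y)⁻¹ + (1 - y) ^ 2 / 2 * ((1 - (t : ℂ) * y)⁻¹) ^ 2)
      (y ^ 3 * ((1 - t : ℝ) : ℂ) ^ 2 / (1 - (t : ℂ) * y) ^ 3) t := by
    intro t ht
    rw [uIcc_of_le zero_le_one] at ht
    have hu : HasDerivAt (fun t : ℝ => 1 - (t : ℂ) * y) (-y) t := by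
      simpa using ((Complex.ofRealCLM.hasDerivAt (x := t)).mul_const y).const_sub 1
    have h0 := hne t ht
    refine (((hu.clog_real (h t ht)).neg.sub ((hu.inv h0).const_mul (2 * (1 - y)))).add
      (((hu.inv h0).pow 2).const_mul ((1 - y) ^ 2 / 2))).congr_deriv ?_
    simp only [Pi.inv_apply]
    push_cast
    field_simp
    ring
  rw [intervalIntegral.integral_eq_sub_of_hasDerivAt key]
  · have h2 : (1 - y) ^ 2 * ((1 - y) ^ 2)⁻¹ = 1 := mul_inv_cancel₀ (pow_ne_zero 2 hy)
    simp [hy]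
    linear_combination h2 / 2
  · apply ContinuousOn.intervalIntegrable
    rw [uIcc_of_le zero_le_one]
    apply ContinuousOn.div (by fun_prop) (by fun_prop)
    intro t ht
    exact pow_ne_zero 3 (hne t ht)

lemma one_sub_mul_mem_slitPlane {y : ℂ} (hy : y.im = 0 → y = 0) (t : ℝ) :
    1 - (t : ℂ) * y ∈ Complex.slitPlane := by
  rw [Complex.mem_slitPlane_iff]
  by_cases ht : t = 0
  · simp [ht]
  by_cases h0 : y.im = 0
  · simp [hy h0]
  · right
    simp [ht, h0]

lemma Vpot_eq {E : ℝ} (hE : |E| < 2) {x : ℂ} (hx : (calE E * x).im = 0 → calE E * x = 0) :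
    Vpot E x = -Complex.log (1 - calE E * x) - calE E * x - (calE E * x) ^ 2 / 2 := by
  rw [← integral_log_remainder _ fun t _ => one_sub_mul_mem_slitPlane hx t, Vpot]
  congr 1
  ext t
  have h0 := calE_ne_zero hE
  have : (starRingEnd ℂ) (calE E) - t * x = (1 - t * (calE E * x)) * (calE E)⁻¹ := by
    rw [conj_calE hE]
    field_simp
  rw [this, mul_pow, mul_pow, inv_pow, ← div_div, div_inv_eq_mul]
  ring

lemma calE_mul_ofReal_im {E : ℝ} (hE : |E| < 2) (a : ℝ) (h : (calE E * a).im = 0) :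
    calE E * a = 0 := by
  simpa [calE_im, (sqrt_pos_of_bulk hE).ne', calE_ne_zero hE] using h

lemma calE_mul_I_mul_im {E : ℝ} (h0 : E ≠ 0) (b : ℝ) (h : (calE E * (Complex.I * b)).im = 0) :
    calE E * (Complex.I * b) = 0 := by
  have : b = 0 := by simpa [calE_re, h0] using h
  simp [this]

lemma le_norm_conj_calE_sub (E a : ℝ) :
    Real.sqrt (1 - E ^ 2 / 4) ≤ ‖(starRingEnd ℂ) (calE E) - a‖ := by
  refine le_trans ?_ (Complex.abs_im_le_norm _)
  simp [calE_im, le_abs_self]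

lemma le_norm_conj_calE_sub_I_mul (E b : ℝ) :
    |E| / 2 ≤ ‖(starRingEnd ℂ) (calE E) - Complex.I * b‖ := by
  refine le_trans ?_ (Complex.abs_re_le_norm _)
  simp [calE_re, abs_div]

lemma conj_calE_sub_ne_zero {E : ℝ} (hE : |E| < 2) (a : ℝ) :
    (starRingEnd ℂ) (calE E) - a ≠ 0 :=
  norm_pos_iff.1 ((sqrt_pos_of_bulk hE).trans_le (le_norm_conj_calE_sub E a))

lemma conj_calE_sub_I_mul_ne_zero {E : ℝ} (h0 : E ≠ 0) (b : ℝ) :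
    (starRingEnd ℂ) (calE E) - Complex.I * b ≠ 0 :=
  norm_pos_iff.1 ((half_pos (abs_pos.2 h0)).trans_le (le_norm_conj_calE_sub_I_mul E b))

lemma one_sub_calE_mul {E : ℝ} (hE : |E| < 2) (x : ℂ) :
    1 - calE E * x = calE E * ((starRingEnd ℂ) (calE E) - x) := by
  rw [mul_sub, calE_mul_conj hE]

lemma hasDerivAt_Vpot {E : ℝ} (hE : |E| < 2) (a : ℝ) :
    HasDerivAt (fun t : ℝ => Vpot E t)
      (((starRingEnd ℂ) (calE E) - a)⁻¹ - calE E - calE E ^ 2 * a) a := by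
  have hV : (fun t : ℝ => Vpot E t) = fun t : ℝ =>
      -Complex.log (1 - calE E * t) - calE E * t - (calE E * t) ^ 2 / 2 :=
    funext fun t => Vpot_eq hE (calE_mul_ofReal_im hE t)
  have hl : HasDerivAt (fun t : ℝ => calE E * (t : ℂ)) (calE E) a := by
    simpa using (Complex.ofRealCLM.hasDerivAt (x := a)).const_mul (calE E)
  have hs := one_sub_mul_mem_slitPlane (calE_mul_ofReal_im hE a) 1
  rw [Complex.ofReal_one, one_mul] at hs
  rw [hV]
  refine ((((hl.const_sub 1).clog_real hs).neg.sub hl).sub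
    ((hl.pow 2).div_const 2)).congr_deriv ?_
  rw [one_sub_calE_mul hE]
  have := calE_ne_zero hE
  have := conj_calE_sub_ne_zero hE a
  field_simp
  ring

lemma continuous_Vpot_ofReal {E : ℝ} (hE : |E| < 2) : Continuous fun a : ℝ => Vpot E a :=
  continuous_iff_continuousAt.2 fun a => (hasDerivAt_Vpot hE a).continuousAt

lemma continuous_Vpot_I_mul {E : ℝ} (hE : |E| < 2) (h0 : E ≠ 0) :
    Continuous fun b : ℝ => Vpot E (Complex.I * b) := by
  simp_rw [fun b : ℝ => Vpot_eq hE (calE_mul_I_mul_im h0 b)]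
  have h : Continuous fun b : ℝ => Complex.log (1 - calE E * (Complex.I * b)) :=
    Continuous.clog (by fun_prop) fun b => by
      simpa using one_sub_mul_mem_slitPlane (calE_mul_I_mul_im h0 b) 1
  fun_prop

lemma norm_exp_Vpot_le {E : ℝ} (hE : |E| < 2) (a : ℝ) :
    ‖Complex.exp (Vpot E a)‖ ≤ (Real.sqrt (1 - E ^ 2 / 4))⁻¹ *
      Real.exp (|a| - (calE E ^ 2).re * a ^ 2 / 2) := by
  have hn : 1 - calE E * a ≠ 0 := by
    rw [one_sub_calE_mul hE]
    exact mul_ne_zero (calE_ne_zero hE) (conj_calE_sub_ne_zero hE a)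
  have hx : (-(calE E * a)).re ≤ |a| := by
    refine (Complex.re_le_norm _).trans ?_
    simp [norm_calE hE]
  rw [Vpot_eq hE (calE_mul_ofReal_im hE a), sub_sub, ← neg_add', neg_add, Complex.exp_add,
    Complex.exp_neg, Complex.exp_log hn, norm_mul, norm_inv]
  gcongr
  · exact sqrt_pos_of_bulk hE
  · rw [one_sub_calE_mul hE, norm_mul, norm_calE hE, one_mul]
    exact le_norm_conj_calE_sub E a
  · rw [Complex.norm_exp]
    gcongr
    have : ((calE E * a) ^ 2 / 2).re = (calE E ^ 2).re * a ^ 2 / 2 := by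
      rw [mul_pow, ← Complex.ofReal_pow, Complex.div_ofNat_re, Complex.re_mul_ofReal]
    rw [neg_add, Complex.add_re, Complex.neg_re ((calE E * a) ^ 2 / 2), this]
    linarith

lemma norm_exp_neg_Vpot_le {E : ℝ} (hE : |E| < 2) (h0 : E ≠ 0) (b : ℝ) :
    ‖Complex.exp (-Vpot E (Complex.I * b))‖ ≤
      Real.exp (2 * |b| - (calE E ^ 2).re * b ^ 2 / 2) := by
  have hn : 1 - calE E * (Complex.I * b) ≠ 0 := by
    rw [one_sub_calE_mul hE]
    exact mul_ne_zero (calE_ne_zero hE) (conj_calE_sub_I_mul_ne_zero h0 b)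
  have hnorm : ‖calE E * (Complex.I * b)‖ = |b| := by simp [norm_calE hE]
  have hx := (Complex.re_le_norm (calE E * (Complex.I * b))).trans_eq hnorm
  have h1 : ‖1 - calE E * (Complex.I * b)‖ ≤ Real.exp |b| := by
    refine (norm_sub_le _ _).trans ?_
    rw [hnorm, norm_one, add_comm]
    exact Real.add_one_le_exp _
  have h2 : ‖Complex.exp (calE E * (Complex.I * b) + (calE E * (Complex.I * b)) ^ 2 / 2)‖ ≤
      Real.exp (|b| - (calE E ^ 2).re * b ^ 2 / 2) := by
    rw [Complex.norm_exp]
    gcongr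
    have : ((calE E * (Complex.I * b)) ^ 2 / 2).re = -((calE E ^ 2).re * b ^ 2 / 2) := by
      rw [mul_pow, mul_pow, Complex.I_sq, neg_one_mul, mul_neg, neg_div, Complex.neg_re,
        ← Complex.ofReal_pow, Complex.div_ofNat_re, Complex.re_mul_ofReal]
    rw [Complex.add_re, this]
    linarith
  have hV : -Vpot E (Complex.I * b) = Complex.log (1 - calE E * (Complex.I * b)) +
      (calE E * (Complex.I * b) + (calE E * (Complex.I * b)) ^ 2 / 2) := by
    rw [Vpot_eq hE (calE_mul_I_mul_im h0 b)]
    ring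
  rw [hV, Complex.exp_add, Complex.exp_log hn, norm_mul]
  refine (mul_le_mul h1 h2 (norm_nonneg _) (Real.exp_pos _).le).trans_eq ?_
  rw [← Real.exp_add]
  ring_nf

lemma update_add_const {d L : ℕ} (i : Site d L) (k : Fin d) (c : ZMod L) :
    Function.update i k (i k + c) = i + Pi.single k c := by
  ext m
  by_cases h : m = k
  · subst h
    simp
  · simp [h]

lemma update_sub_const {d L : ℕ} (i : Site d L) (k : Fin d) (c : ZMod L) :
    Function.update i k (i k - c) = i - Pi.single k c := by
  ext m
  by_cases h : m = k
  · subst h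
    simp
  · simp [h]

lemma negLap_symm (d L : ℕ) [NeZero L] (i j : Site d L) : negLap d L i j = negLap d L j i := by
  unfold negLap
  simp_rw [update_add_const, update_sub_const]
  congr 1
  · simp [eq_comm]
  · refine Finset.sum_congr rfl fun k _ => ?_
    rw [add_comm]
    congr 1 <;> refine if_congr ?_ rfl rfl
    · rw [eq_sub_iff_add_eq, eq_comm]
    · rw [eq_comm, ← eq_sub_iff_add_eq]

lemma negLap_quadratic_nonneg (d L : ℕ) [NeZero L] (a : Site d L → ℝ) :
    0 ≤ ∑ i, ∑ j, negLap d L i j * (a i * a j) := by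
  have row : ∀ i, ∑ j, negLap d L i j * (a i * a j) = ∑ k : Fin d, (2 * a i ^ 2
      - a i * a (i + Pi.single k 1) - a i * a (i - Pi.single k 1)) := by
    intro i
    simp only [negLap, update_add_const, update_sub_const, sub_mul, Finset.sum_sub_distrib,
      Finset.sum_mul, add_mul, ite_mul, zero_mul, one_mul]
    rw [Finset.sum_comm (s := Finset.univ (α := Site d L))]
    simp only [Finset.sum_add_distrib, Finset.sum_ite_eq, Finset.sum_ite_eq', Finset.mem_univ,
      if_true, Finset.sum_const, Finset.card_univ, Fintype.card_fin, nsmul_eq_mul]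
    ring
  have hadd : ∀ v : Site d L, ∑ i, a (i + v) ^ 2 = ∑ i, a i ^ 2 := fun v =>
    Equiv.sum_comp (Equiv.addRight v) fun i => a i ^ 2
  have hsub : ∀ v : Site d L, ∑ i, a (i - v) ^ 2 = ∑ i, a i ^ 2 := fun v =>
    Equiv.sum_comp (Equiv.subRight v) fun i => a i ^ 2
  simp_rw [row]
  rw [Finset.sum_comm]
  refine Finset.sum_nonneg fun k _ => ?_
  have h0 : ∑ i, (a i ^ 2 - a (i + Pi.single k 1) ^ 2 / 2 - a (i - Pi.single k 1) ^ 2 / 2) = 0 := by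
    rw [Finset.sum_sub_distrib, Finset.sum_sub_distrib, ← Finset.sum_div, ← Finset.sum_div,
      hadd, hsub]
    ring
  rw [← h0]
  refine Finset.sum_le_sum fun i _ => ?_
  nlinarith [sq_nonneg (a i - a (i + Pi.single k 1)), sq_nonneg (a i - a (i - Pi.single k 1))]

lemma BmatInv_symm (d L : ℕ) [NeZero L] (W E : ℝ) (i j : Site d L) :
    BmatInv d L W E i j = BmatInv d L W E j i := by
  simp [BmatInv, negLap_symm d L i j, Matrix.one_apply, eq_comm]

lemma le_re_BmatInv_quadratic (d L : ℕ) [NeZero L] (W E : ℝ) (a : Site d L → ℝ) :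
    ∑ i, (1 - (calE E ^ 2).re) * a i ^ 2 ≤
      (∑ i, ∑ j, BmatInv d L W E i j * ((a i * a j : ℝ) : ℂ)).re := by
  have h : (∑ i, ∑ j, BmatInv d L W E i j * ((a i * a j : ℝ) : ℂ)).re =
      W ^ 2 * (∑ i, ∑ j, negLap d L i j * (a i * a j)) +
        ∑ i, (1 - (calE E ^ 2).re) * a i ^ 2 := by
    rw [Finset.mul_sum, ← Finset.sum_add_distrib, Complex.re_sum]
    refine Finset.sum_congr rfl fun i _ => ?_
    have hi : (1 - (calE E ^ 2).re) * a i ^ 2 =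
        ∑ j, if i = j then (1 - (calE E ^ 2).re) * (a i * a j) else 0 := by
      simp [sq]
    rw [hi, Finset.mul_sum, ← Finset.sum_add_distrib, Complex.re_sum]
    refine Finset.sum_congr rfl fun j _ => ?_
    rw [Complex.re_mul_ofReal]
    have hW : ((W : ℂ) ^ 2 * (negLap d L i j : ℂ)).re = W ^ 2 * negLap d L i j := by
      norm_cast
    by_cases hij : i = j
    · simp only [BmatInv, Matrix.add_apply, Matrix.smul_apply, Matrix.map_apply, smul_eq_mul,
        Complex.add_re, hij, Matrix.one_apply_eq, mul_one, Complex.sub_re, Complex.one_re,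
        if_true]
      subst hij
      rw [hW]
      ring
    · simp only [BmatInv, Matrix.add_apply, Matrix.smul_apply, Matrix.map_apply, smul_eq_mul,
        hW, Matrix.one_apply_ne hij, mul_zero, add_zero, if_neg hij]
      ring
  rw [h]
  have := mul_nonneg (sq_nonneg W) (negLap_quadratic_nonneg d L a)
  linarith

lemma integrable_exp_abs_sub_sq : Integrable fun x : ℝ => Real.exp (3 * |x| - x ^ 2 / 2) := by
  refine ((integrable_exp_neg_mul_sq (b := 1 / 4) (by norm_num)).const_mul (Real.exp 9)).mono'
    (by fun_prop) (Eventually.of_forall fun x => ?_)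
  rw [Real.norm_of_nonneg (Real.exp_pos _).le, ← Real.exp_add]
  gcongr
  nlinarith [sq_nonneg (|x| - 6), sq_abs x]

lemma integrable_of_norm_le_exp {ι : Type*} [Fintype ι] {F : (ι → ℝ) × (ι → ℝ) → ℂ}
    (hF : Continuous F) (K : ℝ)
    (h : ∀ p, ‖F p‖ ≤ K * Real.exp (∑ j, (3 * |p.1 j| - p.1 j ^ 2 / 2) +
      ∑ j, (3 * |p.2 j| - p.2 j ^ 2 / 2))) :
    Integrable F := by
  have hprod : Integrable fun x : ι → ℝ => ∏ j, Real.exp (3 * |x j| - x j ^ 2 / 2) :=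
    Integrable.fintype_prod fun _ => integrable_exp_abs_sub_sq
  refine ((hprod.mul_prod hprod).const_mul K).mono' hF.aestronglyMeasurable
    (Eventually.of_forall fun p => ?_)
  simpa only [Real.exp_add, Real.exp_sum] using h p

lemma exists_norm_det_le {X ι : Type*} [Fintype ι] [DecidableEq ι] {A : X → Matrix ι ι ℂ}
    (h : ∀ i j, ∃ K, ∀ p, ‖A p i j‖ ≤ K) : ∃ K, ∀ p, ‖(A p).det‖ ≤ K := by
  choose K hK using h
  refine ⟨_, fun p => Matrix.det_le (abv := NormedField.toAbsoluteValue ℂ)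
    (x := ∑ i, ∑ j, |K i j|) fun i j => ?_⟩
  calc ‖A p i j‖ ≤ |K i j| := (hK i j p).trans (le_abs_self _)
    _ ≤ ∑ j, |K i j| :=
      Finset.single_le_sum (f := fun j => |K i j|) (fun _ _ => abs_nonneg _) (Finset.mem_univ j)
    _ ≤ _ := Finset.single_le_sum (f := fun i => ∑ j, |K i j|)
      (fun _ _ => Finset.sum_nonneg fun _ _ => abs_nonneg _) (Finset.mem_univ i)

lemma hasDerivAt_det_one_add_diagonal_mul {ι : Type*} [Fintype ι] [DecidableEq ι] (δ : ι → ℂ)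
    (B : Matrix ι ι ℂ) (l : ι) {g : ℝ → ℂ} {g' : ℂ} {t : ℝ} (hg : HasDerivAt g g' t) :
    HasDerivAt (fun t => (1 + Matrix.diagonal (Function.update δ l (g t)) * B).det)
      (g' * ((1 + Matrix.diagonal δ * B).updateRow l (B l)).det) t := by
  have h : ∀ z : ℂ, (1 + Matrix.diagonal (Function.update δ l z) * B).det =
      ((1 + Matrix.diagonal δ * B).updateRow l (Pi.single l 1)).det +
        z * ((1 + Matrix.diagonal δ * B).updateRow l (B l)).det := by
    intro z
    rw [← Matrix.det_updateRow_smul, ← Matrix.det_updateRow_add]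
    congr 1
    ext i j
    by_cases hi : i = l
    · subst hi
      simp [Matrix.one_apply, Pi.single_apply, eq_comm]
    · simp [hi]
  simp_rw [h]
  exact (hg.mul_const _).const_add _

lemma hasLineDerivAt_of_update {ι : Type*} [DecidableEq ι] [Fintype ι]
    {F : (ι → ℝ) → (ι → ℝ) → ℂ} {F' : ℂ} {p : (ι → ℝ) × (ι → ℝ)} {l : ι}
    (h : HasDerivAt (fun t => F (Function.update p.1 l t) p.2) F' (p.1 l)) :
    HasLineDerivAt ℝ (fun q : (ι → ℝ) × (ι → ℝ) => F q.1 q.2) F' p (Pi.single l 1, 0) := by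
  have hp : ∀ t : ℝ, p + t • ((Pi.single l 1, 0) : (ι → ℝ) × (ι → ℝ)) =
      (Function.update p.1 l (p.1 l + t), p.2) := by
    intro t
    ext m
    · by_cases hm : m = l
      · subst hm
        simp
      · simp [hm]
    · simp
  unfold HasLineDerivAt
  simp_rw [hp]
  rw [← add_zero (p.1 l)] at h
  exact h.comp_const_add (p.1 l) 0

lemma hasDerivAt_update_apply {ι : Type*} [DecidableEq ι] (a : ι → ℝ) (l i : ι) (x : ℝ) :
    HasDerivAt (fun t => Function.update a l t i) (if i = l then 1 else 0) x := by
  by_cases h : i = l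
  · subst h
    simpa using hasDerivAt_id' x
  · simpa [h] using hasDerivAt_const x (a i)

lemma hasDerivAt_gaussDensityB (d L : ℕ) [NeZero L] (W E : ℝ) (a b : Site d L → ℝ)
    (l : Site d L) :
    HasDerivAt (fun t => gaussDensityB d L W E (Function.update a l t) b)
      (-(∑ j, BmatInv d L W E l j * (a j : ℂ)) * gaussDensityB d L W E a b) (a l) := by
  have hq : HasDerivAt (fun t => ∑ i, ∑ j, BmatInv d L W E i j *
      ((Function.update a l t i * Function.update a l t j : ℝ) : ℂ))
      (2 * ∑ j, BmatInv d L W E l j * (a j : ℂ)) (a l) := by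
    refine (HasDerivAt.fun_sum fun i _ => HasDerivAt.fun_sum fun j _ =>
      (((hasDerivAt_update_apply a l i (a l)).mul
        (hasDerivAt_update_apply a l j (a l))).ofReal_comp).const_mul
          (BmatInv d L W E i j)).congr_deriv ?_
    simp only [Function.update_eq_self, Complex.ofReal_add, mul_add, Finset.sum_add_distrib,
      two_mul, apply_ite Complex.ofReal,
      Complex.ofReal_zero, ite_mul, mul_ite, one_mul, mul_one, zero_mul, mul_zero]
    congr 1
    · rw [Finset.sum_comm]
      simp
    · simp [BmatInv_symm d L W E l]
  refine ((((hq.add_const _).const_mul (-(1 / 2) : ℂ)).cexp).const_mul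
    ((2 * (Real.pi : ℂ))⁻¹ • BmatInv d L W E).det).congr_deriv ?_
  simp only [Function.update_eq_self, gaussDensityB]
  ring

/-- The diagonal entry of `D(a,b)` at a site with field values `x` and `y`. -/
def Dentry (E x y : ℝ) : ℂ :=
  calE E ^ 2 - 1 / (((starRingEnd ℂ) (calE E) - (x : ℂ)) *
    ((starRingEnd ℂ) (calE E) - Complex.I * (y : ℂ)))

lemma hasDerivAt_Dentry {E : ℝ} (hE : |E| < 2) (h0 : E ≠ 0) (x y : ℝ) :
    HasDerivAt (fun t => Dentry E t y) (-(((starRingEnd ℂ) (calE E) - (x : ℂ)) ^ 2 *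
      ((starRingEnd ℂ) (calE E) - Complex.I * (y : ℂ)))⁻¹) x := by
  have hx := conj_calE_sub_ne_zero hE x
  have hy := conj_calE_sub_I_mul_ne_zero h0 y
  have hl : HasDerivAt (fun t : ℝ => ((starRingEnd ℂ) (calE E) - (t : ℂ)) *
      ((starRingEnd ℂ) (calE E) - Complex.I * (y : ℂ)))
      (-((starRingEnd ℂ) (calE E) - Complex.I * (y : ℂ))) x := by
    simpa using ((Complex.ofRealCLM.hasDerivAt (x := x)).const_sub
      ((starRingEnd ℂ) (calE E))).mul_const ((starRingEnd ℂ) (calE E) - Complex.I * (y : ℂ))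
  unfold Dentry
  simp_rw [one_div]
  refine ((hl.inv (mul_ne_zero hx hy)).const_sub (calE E ^ 2)).congr_deriv ?_
  field_simp

lemma norm_Dentry_le {E : ℝ} (hE : |E| < 2) (h0 : E ≠ 0) (x y : ℝ) :
    ‖Dentry E x y‖ ≤ 1 + (Real.sqrt (1 - E ^ 2 / 4) * (|E| / 2))⁻¹ := by
  refine (norm_sub_le _ _).trans ?_
  rw [norm_pow, norm_calE hE, one_pow, one_div, norm_inv, norm_mul]
  have := sqrt_pos_of_bulk hE
  have := abs_pos.2 h0
  gcongr
  · exact le_norm_conj_calE_sub E x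
  · exact le_norm_conj_calE_sub_I_mul E y

lemma continuous_Dentry {E : ℝ} (hE : |E| < 2) (h0 : E ≠ 0) :
    Continuous fun p : ℝ × ℝ => Dentry E p.1 p.2 := by
  unfold Dentry
  refine continuous_const.sub (continuous_const.div (by fun_prop) fun p => ?_)
  exact mul_ne_zero (conj_calE_sub_ne_zero hE p.1) (conj_calE_sub_I_mul_ne_zero h0 p.2)

lemma hasDerivAt_exp_calV {E : ℝ} (hE : |E| < 2) (d L : ℕ) [NeZero L] (a b : Site d L → ℝ)
    (l : Site d L) :
    HasDerivAt (fun t => Complex.exp (calV d L E (Function.update a l t) b))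
      (Complex.exp (calV d L E a b) *
        (((starRingEnd ℂ) (calE E) - a l)⁻¹ - calE E - calE E ^ 2 * a l)) (a l) := by
  have hV : HasDerivAt (fun t => calV d L E (Function.update a l t) b)
      (((starRingEnd ℂ) (calE E) - a l)⁻¹ - calE E - calE E ^ 2 * a l) (a l) := by
    have hj : ∀ j, HasDerivAt (fun t => Vpot E (Function.update a l t j) -
        Vpot E (Complex.I * (b j : ℂ)))
        (if j = l then ((starRingEnd ℂ) (calE E) - a l)⁻¹ - calE E - calE E ^ 2 * a l else 0)
        (a l) := by
      intro j
      by_cases h : j = l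
      · subst h
        simpa using (hasDerivAt_Vpot hE (a j)).sub_const (Vpot E (Complex.I * (b j : ℂ)))
      · simpa [h] using hasDerivAt_const (a l) (Vpot E (a j) - Vpot E (Complex.I * (b j : ℂ)))
    simpa [calV] using HasDerivAt.fun_sum fun j (_ : j ∈ Finset.univ) => hj j
  simpa using hV.cexp

/-- The quotient of `∂_{a_l} R` by `e^{𝒱}`. -/
def derivFactor (d L : ℕ) [NeZero L] (W E : ℝ) (l : Site d L)
    (p : (Site d L → ℝ) × (Site d L → ℝ)) : ℂ :=
  -(((starRingEnd ℂ) (calE E) - (p.1 l : ℂ)) ^ 2 *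
      ((starRingEnd ℂ) (calE E) - Complex.I * (p.2 l : ℂ)))⁻¹ *
    ((1 + Dmat d L E p.1 p.2 * Bmat d L W E).updateRow l (Bmat d L W E l)).det +
  (1 + Dmat d L E p.1 p.2 * Bmat d L W E).det *
    (((starRingEnd ℂ) (calE E) - p.1 l)⁻¹ - calE E - calE E ^ 2 * p.1 l)

lemma hasDerivAt_Rfun {E : ℝ} (hE : |E| < 2) (h0 : E ≠ 0) (d L : ℕ) [NeZero L] (W : ℝ)
    (p : (Site d L → ℝ) × (Site d L → ℝ)) (l : Site d L) :
    HasDerivAt (fun t => Rfun d L W E (Function.update p.1 l t) p.2)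
      (derivFactor d L W E l p * Complex.exp (calV d L E p.1 p.2)) (p.1 l) := by
  have hD : ∀ t, Dmat d L E (Function.update p.1 l t) p.2 = Matrix.diagonal
      (Function.update (fun j => Dentry E (p.1 j) (p.2 j)) l (Dentry E t (p.2 l))) := by
    intro t
    unfold Dmat
    congr 1
    ext j
    by_cases h : j = l
    · subst h
      simp [Dentry]
    · simp [h, Dentry]
  unfold Rfun
  have hdet := hasDerivAt_det_one_add_diagonal_mul (fun j => Dentry E (p.1 j) (p.2 j))
    (Bmat d L W E) l (hasDerivAt_Dentry hE h0 (p.1 l) (p.2 l))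
  simp_rw [← hD] at hdet
  refine (hdet.mul (hasDerivAt_exp_calV hE d L p.1 p.2 l)).congr_deriv ?_
  simp only [Function.update_eq_self, derivFactor]
  change _ * ((1 + Dmat d L E p.1 p.2 * _).updateRow l _).det * _ + _ = _
  ring

lemma one_add_Dmat_mul_apply (d L : ℕ) [NeZero L] (W E : ℝ) (a b : Site d L → ℝ)
    (i j : Site d L) :
    (1 + Dmat d L E a b * Bmat d L W E) i j =
      (1 : Matrix (Site d L) (Site d L) ℂ) i j + Dentry E (a i) (b i) * Bmat d L W E i j := by
  simp [Dmat, Dentry, Matrix.diagonal_mul]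

lemma continuous_one_add_mul {X ι : Type*} [TopologicalSpace X] [Fintype ι] [DecidableEq ι]
    {A : X → Matrix ι ι ℂ} (hA : Continuous A) (B : Matrix ι ι ℂ) :
    Continuous fun p => 1 + A p * B :=
  continuous_const.add (hA.matrix_mul continuous_const)

lemma continuous_diagonal_of_continuous_prod {ι : Type*} [DecidableEq ι] {f : ℝ → ℝ → ℂ}
    (hf : Continuous fun p : ℝ × ℝ => f p.1 p.2) :
    Continuous fun p : (ι → ℝ) × (ι → ℝ) => Matrix.diagonal fun j => f (p.1 j) (p.2 j) :=
  Continuous.matrix_diagonal (continuous_pi fun j =>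
    hf.comp (g := fun q : ℝ × ℝ => f q.1 q.2) (f := fun p : (ι → ℝ) × (ι → ℝ) => (p.1 j, p.2 j))
      (by fun_prop))

lemma continuous_one_add_Dmat_mul {E : ℝ} (hE : |E| < 2) (h0 : E ≠ 0) (d L : ℕ) [NeZero L]
    (W : ℝ) : Continuous fun p : (Site d L → ℝ) × (Site d L → ℝ) =>
      1 + Dmat d L E p.1 p.2 * Bmat d L W E := by
  have hD : Continuous fun p : (Site d L → ℝ) × (Site d L → ℝ) => Dmat d L E p.1 p.2 :=
    continuous_diagonal_of_continuous_prod (continuous_Dentry hE h0)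
  exact continuous_one_add_mul hD _

lemma exists_norm_one_add_Dmat_mul_le {E : ℝ} (hE : |E| < 2) (h0 : E ≠ 0) (d L : ℕ) [NeZero L]
    (W : ℝ) (i j : Site d L) : ∃ K, ∀ p : (Site d L → ℝ) × (Site d L → ℝ),
      ‖(1 + Dmat d L E p.1 p.2 * Bmat d L W E) i j‖ ≤ K := by
  refine ⟨‖(1 : Matrix (Site d L) (Site d L) ℂ) i j‖ +
    (1 + (Real.sqrt (1 - E ^ 2 / 4) * (|E| / 2))⁻¹) * ‖Bmat d L W E i j‖, fun p => ?_⟩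
  rw [one_add_Dmat_mul_apply]
  refine (norm_add_le _ _).trans (add_le_add_right ?_ _)
  rw [norm_mul]
  exact mul_le_mul_of_nonneg_right (norm_Dentry_le hE h0 _ _) (norm_nonneg _)

lemma exists_norm_det_updateRow_le {E : ℝ} (hE : |E| < 2) (h0 : E ≠ 0) (d L : ℕ) [NeZero L]
    (W : ℝ) (l : Site d L) : ∃ K, ∀ p : (Site d L → ℝ) × (Site d L → ℝ),
      ‖((1 + Dmat d L E p.1 p.2 * Bmat d L W E).updateRow l (Bmat d L W E l)).det‖ ≤ K := by
  refine exists_norm_det_le fun i j => ?_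
  by_cases h : i = l
  · subst h
    exact ⟨‖Bmat d L W E i j‖, fun p => by simp⟩
  · simpa [Matrix.updateRow_ne h] using exists_norm_one_add_Dmat_mul_le hE h0 d L W i j

lemma continuous_derivFactor {E : ℝ} (hE : |E| < 2) (h0 : E ≠ 0) (d L : ℕ) [NeZero L]
    (W : ℝ) (l : Site d L) : Continuous (derivFactor d L W E l) := by
  have hM := continuous_one_add_Dmat_mul hE h0 d L W
  have h1 : Continuous fun p : (Site d L → ℝ) × (Site d L → ℝ) =>
      (((starRingEnd ℂ) (calE E) - (p.1 l : ℂ)) ^ 2 *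
        ((starRingEnd ℂ) (calE E) - Complex.I * (p.2 l : ℂ)))⁻¹ :=
    Continuous.inv₀ (by fun_prop) fun p => mul_ne_zero
      (pow_ne_zero 2 (conj_calE_sub_ne_zero hE _)) (conj_calE_sub_I_mul_ne_zero h0 _)
  have h2 : Continuous fun p : (Site d L → ℝ) × (Site d L → ℝ) =>
      ((starRingEnd ℂ) (calE E) - (p.1 l : ℂ))⁻¹ :=
    Continuous.inv₀ (by fun_prop) fun p => conj_calE_sub_ne_zero hE _
  exact (h1.neg.mul (hM.matrix_updateRow l continuous_const).matrix_det).add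
    (hM.matrix_det.mul ((h2.sub continuous_const).sub (by fun_prop)))

lemma exists_norm_derivFactor_le {E : ℝ} (hE : |E| < 2) (h0 : E ≠ 0) (d L : ℕ) [NeZero L]
    (W : ℝ) (l : Site d L) : ∃ K, ∀ p, ‖derivFactor d L W E l p‖ ≤ K * (1 + ‖p.1‖) := by
  obtain ⟨K₁, hK₁⟩ := exists_norm_det_updateRow_le hE h0 d L W l
  obtain ⟨K₂, hK₂⟩ := exists_norm_det_le (exists_norm_one_add_Dmat_mul_le hE h0 d L W)
  have hs := sqrt_pos_of_bulk hE
  have h0' := abs_pos.2 h0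
  set s := Real.sqrt (1 - E ^ 2 / 4)
  have hK₁0 := (norm_nonneg _).trans (hK₁ 0)
  have hK₂0 := (norm_nonneg _).trans (hK₂ 0)
  refine ⟨(s ^ 2 * (|E| / 2))⁻¹ * K₁ + K₂ * (s⁻¹ + 1), fun p => ?_⟩
  have ha : |p.1 l| ≤ ‖p.1‖ := norm_le_pi_norm p.1 l
  have hx := le_norm_conj_calE_sub E (p.1 l)
  have hy := le_norm_conj_calE_sub_I_mul E (p.2 l)
  have hinv : ‖((starRingEnd ℂ) (calE E) - (p.1 l : ℂ))⁻¹‖ ≤ s⁻¹ := by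
    rw [norm_inv]
    gcongr
  have h1 : ‖-(((starRingEnd ℂ) (calE E) - (p.1 l : ℂ)) ^ 2 *
      ((starRingEnd ℂ) (calE E) - Complex.I * (p.2 l : ℂ)))⁻¹‖ ≤ (s ^ 2 * (|E| / 2))⁻¹ := by
    rw [norm_neg, norm_inv, norm_mul, norm_pow]
    gcongr
  have h2 : ‖((starRingEnd ℂ) (calE E) - p.1 l)⁻¹ - calE E - calE E ^ 2 * p.1 l‖ ≤
      (s⁻¹ + 1) * (1 + ‖p.1‖) := by
    have h3 : ‖calE E ^ 2 * (p.1 l : ℂ)‖ ≤ ‖p.1‖ := by simpa [norm_calE hE] using ha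
    have h4 := norm_sub_le (((starRingEnd ℂ) (calE E) - (p.1 l : ℂ))⁻¹ - calE E)
      (calE E ^ 2 * p.1 l)
    have h5 := norm_sub_le ((starRingEnd ℂ) (calE E) - (p.1 l : ℂ))⁻¹ (calE E)
    rw [norm_calE hE] at h5
    have := mul_nonneg (inv_pos.2 hs).le (norm_nonneg p.1)
    linarith
  calc ‖derivFactor d L W E l p‖ ≤ (s ^ 2 * (|E| / 2))⁻¹ * K₁ +
        K₂ * ((s⁻¹ + 1) * (1 + ‖p.1‖)) := by
        refine (norm_add_le _ _).trans ?_
        rw [norm_mul, norm_mul]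
        gcongr
        · exact hK₁ p
        · exact hK₂ p
    _ ≤ _ := by
        have : 0 ≤ (s ^ 2 * (|E| / 2))⁻¹ * K₁ * ‖p.1‖ := by positivity
        linarith

lemma continuous_gaussDensityB (d L : ℕ) [NeZero L] (W E : ℝ) :
    Continuous fun p : (Site d L → ℝ) × (Site d L → ℝ) => gaussDensityB d L W E p.1 p.2 := by
  unfold gaussDensityB
  fun_prop

lemma continuous_calV {E : ℝ} (hE : |E| < 2) (h0 : E ≠ 0) (d L : ℕ) [NeZero L] :
    Continuous fun p : (Site d L → ℝ) × (Site d L → ℝ) => calV d L E p.1 p.2 := by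
  unfold calV
  exact continuous_finsetSum _ fun j _ =>
    ((continuous_Vpot_ofReal hE).comp ((continuous_apply j).comp continuous_fst)).sub
      ((continuous_Vpot_I_mul hE h0).comp ((continuous_apply j).comp continuous_snd))

lemma norm_gaussDensityB_le (d L : ℕ) [NeZero L] (W E : ℝ) (a b : Site d L → ℝ) :
    ‖gaussDensityB d L W E a b‖ ≤ ‖((2 * (Real.pi : ℂ))⁻¹ • BmatInv d L W E).det‖ *
      Real.exp (-(∑ j, (1 - (calE E ^ 2).re) * a j ^ 2) / 2 -
        (∑ j, (1 - (calE E ^ 2).re) * b j ^ 2) / 2) := by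
  rw [gaussDensityB, norm_mul, Complex.norm_exp]
  gcongr
  have ha := le_re_BmatInv_quadratic d L W E a
  have hb := le_re_BmatInv_quadratic d L W E b
  have hc : (-(1 / 2) : ℂ) = ((-(1 / 2) : ℝ) : ℂ) := by push_cast; rfl
  rw [hc, Complex.re_ofReal_mul, Complex.add_re]
  linarith

lemma norm_exp_calV_le {E : ℝ} (hE : |E| < 2) (h0 : E ≠ 0) (d L : ℕ) [NeZero L]
    (a b : Site d L → ℝ) :
    ‖Complex.exp (calV d L E a b)‖ ≤ (Real.sqrt (1 - E ^ 2 / 4))⁻¹ ^ Fintype.card (Site d L) *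
      Real.exp (∑ j, (|a j| - (calE E ^ 2).re * a j ^ 2 / 2) +
        ∑ j, (2 * |b j| - (calE E ^ 2).re * b j ^ 2 / 2)) := by
  have hle : ∏ j, ‖Complex.exp (Vpot E (a j))‖ * ‖Complex.exp (-Vpot E (Complex.I * b j))‖ ≤
      ∏ j, ((Real.sqrt (1 - E ^ 2 / 4))⁻¹ * Real.exp (|a j| - (calE E ^ 2).re * a j ^ 2 / 2)) *
        Real.exp (2 * |b j| - (calE E ^ 2).re * b j ^ 2 / 2) :=
    Finset.prod_le_prod (fun _ _ => by positivity) fun j _ =>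
      mul_le_mul (norm_exp_Vpot_le hE (a j)) (norm_exp_neg_Vpot_le hE h0 (b j))
        (norm_nonneg _) (by positivity)
  rw [calV, Complex.exp_sum, norm_prod]
  simp_rw [sub_eq_add_neg (Vpot E _), Complex.exp_add, norm_mul]
  refine hle.trans_eq ?_
  rw [Finset.prod_mul_distrib, Finset.prod_mul_distrib, Finset.prod_const, Finset.card_univ,
    Real.exp_add, Real.exp_sum, Real.exp_sum, mul_assoc]

lemma norm_gaussDensityB_mul_exp_calV_le {E : ℝ} (hE : |E| < 2) (h0 : E ≠ 0) (d L : ℕ)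
    [NeZero L] (W : ℝ) : ∃ K, 0 ≤ K ∧ ∀ a b : Site d L → ℝ,
    ‖gaussDensityB d L W E a b * Complex.exp (calV d L E a b)‖ ≤
      K * Real.exp (∑ j, (2 * |a j| - a j ^ 2 / 2) + ∑ j, (2 * |b j| - b j ^ 2 / 2)) := by
  refine ⟨‖((2 * (Real.pi : ℂ))⁻¹ • BmatInv d L W E).det‖ *
    (Real.sqrt (1 - E ^ 2 / 4))⁻¹ ^ Fintype.card (Site d L), by positivity, fun a b => ?_⟩
  rw [norm_mul]
  refine (mul_le_mul (norm_gaussDensityB_le d L W E a b) (norm_exp_calV_le hE h0 d L a b)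
    (norm_nonneg _) (by positivity)).trans ?_
  rw [mul_mul_mul_comm, ← Real.exp_add]
  refine mul_le_mul_of_nonneg_left (Real.exp_le_exp.2 ?_) (by positivity)
  have hsplit : ∀ (κ r : ℝ) (x : Site d L → ℝ), ∑ j, (κ * |x j| - r * x j ^ 2 / 2) =
      κ * ∑ j, |x j| - r * (∑ j, x j ^ 2) / 2 := by
    intro κ r x
    rw [Finset.sum_sub_distrib, Finset.mul_sum, ← Finset.sum_div, Finset.mul_sum]
  have h1 := hsplit 1 (calE E ^ 2).re a
  have h2 := hsplit 2 (calE E ^ 2).re b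
  have h3 := hsplit 2 1 a
  have h4 := hsplit 2 1 b
  simp only [one_mul] at h1 h3 h4
  rw [h1, h2, h3, h4, ← Finset.mul_sum, ← Finset.mul_sum]
  have : 0 ≤ ∑ j, |a j| := Finset.sum_nonneg fun _ _ => abs_nonneg _
  linarith

lemma integrable_gaussDensityB_mul_exp_calV_mul {E : ℝ} (hE : |E| < 2) (h0 : E ≠ 0) (d L : ℕ)
    [NeZero L] (W : ℝ) {T : (Site d L → ℝ) × (Site d L → ℝ) → ℂ} (hT : Continuous T)
    (hK : ∃ K, ∀ p, ‖T p‖ ≤ K * (1 + ‖p.1‖)) :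
    Integrable fun p : (Site d L → ℝ) × (Site d L → ℝ) =>
      gaussDensityB d L W E p.1 p.2 * Complex.exp (calV d L E p.1 p.2) * T p := by
  obtain ⟨K, hK⟩ := hK
  obtain ⟨K₁, hK₁, hw⟩ := norm_gaussDensityB_mul_exp_calV_le hE h0 d L W
  have hK0 : 0 ≤ K := by simpa using (norm_nonneg _).trans (hK 0)
  refine integrable_of_norm_le_exp (((continuous_gaussDensityB d L W E).mul
    (continuous_calV hE h0 d L).cexp).mul hT) (K₁ * K) fun p => ?_
  have hp : 1 + ‖p.1‖ ≤ Real.exp (∑ j, |p.1 j|) := by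
    have : ‖p.1‖ ≤ ∑ j, |p.1 j| :=
      (pi_norm_le_iff_of_nonneg (Finset.sum_nonneg fun _ _ => abs_nonneg _)).2 fun j =>
        Finset.single_le_sum (f := fun j => |p.1 j|) (fun _ _ => abs_nonneg _)
          (Finset.mem_univ j)
    linarith [Real.add_one_le_exp (∑ j, |p.1 j|)]
  rw [norm_mul]
  calc _ ≤ K₁ * Real.exp (∑ j, (2 * |p.1 j| - p.1 j ^ 2 / 2) +
        ∑ j, (2 * |p.2 j| - p.2 j ^ 2 / 2)) * (K * Real.exp (∑ j, |p.1 j|)) :=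
        mul_le_mul (hw p.1 p.2) ((hK p).trans (by gcongr)) (norm_nonneg _) (by positivity)
    _ = K₁ * K * Real.exp ((∑ j, (2 * |p.1 j| - p.1 j ^ 2 / 2) +
        ∑ j, (2 * |p.2 j| - p.2 j ^ 2 / 2)) + ∑ j, |p.1 j|) := by
        rw [Real.exp_add _ (∑ j, |p.1 j|)]
        ring
    _ ≤ _ := by
        rw [add_right_comm, ← Finset.sum_add_distrib]
        gcongr with j _ j _
        · linarith
        · norm_num

lemma isAddHaarMeasure_volume_prod (ι : Type*) [Fintype ι] :
    (volume : Measure ((ι → ℝ) × (ι → ℝ))).IsAddHaarMeasure :=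
  Measure.prod.instIsAddHaarMeasure _ _

/-- Gaussian integration by parts in a single direction `a_l`. -/
lemma integral_gaussDensityB_mul_deriv_Rfun {E : ℝ} (hE : |E| < 2) (h0 : E ≠ 0) (d L : ℕ)
    [NeZero L] (W : ℝ) (l : Site d L)
    (hR : Integrable fun p : (Site d L → ℝ) × (Site d L → ℝ) =>
      gaussDensityB d L W E p.1 p.2 * Rfun d L W E p.1 p.2)
    (hRa : ∀ j, Integrable fun p : (Site d L → ℝ) × (Site d L → ℝ) =>
      gaussDensityB d L W E p.1 p.2 * Rfun d L W E p.1 p.2 * (p.1 j : ℂ))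
    (hR' : Integrable fun p : (Site d L → ℝ) × (Site d L → ℝ) =>
      gaussDensityB d L W E p.1 p.2 *
        deriv (fun t => Rfun d L W E (Function.update p.1 l t) p.2) (p.1 l)) :
    ∫ p : (Site d L → ℝ) × (Site d L → ℝ), gaussDensityB d L W E p.1 p.2 *
        deriv (fun t => Rfun d L W E (Function.update p.1 l t) p.2) (p.1 l) =
      ∑ j, BmatInv d L W E l j * ∫ p : (Site d L → ℝ) × (Site d L → ℝ),
        gaussDensityB d L W E p.1 p.2 * Rfun d L W E p.1 p.2 * (p.1 j : ℂ) := by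
  have hsum : ∀ p : (Site d L → ℝ) × (Site d L → ℝ),
      -(∑ j, BmatInv d L W E l j * (p.1 j : ℂ)) * gaussDensityB d L W E p.1 p.2 *
        Rfun d L W E p.1 p.2 = -∑ j, BmatInv d L W E l j *
          (gaussDensityB d L W E p.1 p.2 * Rfun d L W E p.1 p.2 * (p.1 j : ℂ)) := by
    intro p
    rw [neg_mul, neg_mul, Finset.sum_mul, Finset.sum_mul]
    congr 1
    exact Finset.sum_congr rfl fun j _ => by ring
  have hint : Integrable fun p : (Site d L → ℝ) × (Site d L → ℝ) => ∑ j, BmatInv d L W E l j *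
      (gaussDensityB d L W E p.1 p.2 * Rfun d L W E p.1 p.2 * (p.1 j : ℂ)) :=
    integrable_finsetSum _ fun j _ => (hRa j).const_mul _
  have := isAddHaarMeasure_volume_prod (Site d L)
  have key := integral_bilinear_hasLineDerivAt_right_eq_neg_left_of_integrable
    (μ := (volume : Measure ((Site d L → ℝ) × (Site d L → ℝ))))
    (B := ContinuousLinearMap.mul ℝ ℂ)
    (f := fun p => gaussDensityB d L W E p.1 p.2)
    (f' := fun p => -(∑ j, BmatInv d L W E l j * (p.1 j : ℂ)) * gaussDensityB d L W E p.1 p.2)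
    (g := fun p => Rfun d L W E p.1 p.2)
    (g' := fun p => deriv (fun t => Rfun d L W E (Function.update p.1 l t) p.2) (p.1 l))
    (v := (Pi.single l 1, 0))
    (by
      simp only [ContinuousLinearMap.mul_apply', hsum]
      exact hint.neg)
    (by simpa only [ContinuousLinearMap.mul_apply'] using hR')
    (by simpa only [ContinuousLinearMap.mul_apply'] using hR)
    (fun p _ => hasLineDerivAt_of_update (hasDerivAt_gaussDensityB d L W E p.1 p.2 l))
    (fun p _ => hasLineDerivAt_of_update
      (hasDerivAt_Rfun hE h0 d L W p l).differentiableAt.hasDerivAt)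
  simp only [ContinuousLinearMap.mul_apply', hsum] at key
  rw [key, integral_neg, neg_neg, integral_finsetSum _ fun j _ => (hRa j).const_mul _]
  simp_rw [integral_const_mul]

/-- Gaussian integration by parts for the remainder: for `Λ = (ℤ/Lℤ)^d`,
`d ≥ 1`, and `E ∈ I = {η < |E| ≤ 1.8}`, all the integrals below are absolutely convergent
and `∫ dμ_B(a,b) R(a,b) a₀ = Σ_{l₀} B_{0 l₀} ∫ dμ_B(a,b) ∂_{a_{l₀}} R(a,b)`. -/
theorem gaussian_integration_by_parts (η : ℝ) (hη : 0 < η) (d L : ℕ) [NeZero L] (hd : 1 ≤ d)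
    (W : ℝ) (hW : 1 ≤ W) (E : ℝ) (hE : E ∈ bulkInterval η) :
    Integrable (fun p : (Site d L → ℝ) × (Site d L → ℝ) =>
      gaussDensityB d L W E p.1 p.2 * Rfun d L W E p.1 p.2 * ((p.1 0 : ℝ) : ℂ)) ∧
    (∀ l₀ : Site d L,
      Integrable (fun p : (Site d L → ℝ) × (Site d L → ℝ) =>
        gaussDensityB d L W E p.1 p.2 *
          deriv (fun t => Rfun d L W E (Function.update p.1 l₀ t) p.2) (p.1 l₀))) ∧
    (∫ p : (Site d L → ℝ) × (Site d L → ℝ),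
        gaussDensityB d L W E p.1 p.2 * Rfun d L W E p.1 p.2 * ((p.1 0 : ℝ) : ℂ)) =
      ∑ l₀ : Site d L, Bmat d L W E 0 l₀ *
        ∫ p : (Site d L → ℝ) × (Site d L → ℝ),
          gaussDensityB d L W E p.1 p.2 *
            deriv (fun t => Rfun d L W E (Function.update p.1 l₀ t) p.2) (p.1 l₀) := by
  have hE2 : |E| < 2 := hE.2.trans_lt (by norm_num)
  have h0 : E ≠ 0 := abs_pos.1 (hη.trans hE.1)
  obtain ⟨K, hK⟩ := exists_norm_det_le (exists_norm_one_add_Dmat_mul_le hE2 h0 d L W)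
  have hK0 := (norm_nonneg _).trans (hK 0)
  have hdet := (continuous_one_add_Dmat_mul hE2 h0 d L W).matrix_det
  have hR : Integrable fun p : (Site d L → ℝ) × (Site d L → ℝ) =>
      gaussDensityB d L W E p.1 p.2 * Rfun d L W E p.1 p.2 := by
    refine (integrable_gaussDensityB_mul_exp_calV_mul hE2 h0 d L W hdet
      ⟨K, fun p => (hK p).trans ?_⟩).congr (Eventually.of_forall fun p => ?_)
    · nlinarith [norm_nonneg p.1]
    · simp only [Rfun]
      ring
  have hRa : ∀ j, Integrable fun p : (Site d L → ℝ) × (Site d L → ℝ) =>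
      gaussDensityB d L W E p.1 p.2 * Rfun d L W E p.1 p.2 * (p.1 j : ℂ) := by
    intro j
    refine (integrable_gaussDensityB_mul_exp_calV_mul hE2 h0 d L W
      (hdet.mul (by fun_prop : Continuous fun p : (Site d L → ℝ) × (Site d L → ℝ) =>
        (p.1 j : ℂ))) ⟨K, fun p => ?_⟩).congr (Eventually.of_forall fun p => ?_)
    · rw [Pi.mul_apply, norm_mul]
      have hj : ‖(p.1 j : ℂ)‖ ≤ 1 + ‖p.1‖ := by
        rw [Complex.norm_real]
        linarith [norm_le_pi_norm p.1 j]
      exact mul_le_mul (hK p) hj (norm_nonneg _) hK0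
    · simp only [Pi.mul_apply, Rfun]
      ring
  have hR' : ∀ l, Integrable fun p : (Site d L → ℝ) × (Site d L → ℝ) =>
      gaussDensityB d L W E p.1 p.2 *
        deriv (fun t => Rfun d L W E (Function.update p.1 l t) p.2) (p.1 l) := by
    intro l
    refine (integrable_gaussDensityB_mul_exp_calV_mul hE2 h0 d L W
      (continuous_derivFactor hE2 h0 d L W l) (exists_norm_derivFactor_le hE2 h0 d L W l)).congr
        (Eventually.of_forall fun p => ?_)
    simp only [(hasDerivAt_Rfun hE2 h0 d L W p l).deriv]
    ring
  refine ⟨hRa 0, hR', ?_⟩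
  by_cases hu : IsUnit (BmatInv d L W E).det
  · simp_rw [fun l => integral_gaussDensityB_mul_deriv_Rfun hE2 h0 d L W l hR hRa (hR' l)]
    set I : Site d L → ℂ := fun j => ∫ p : (Site d L → ℝ) × (Site d L → ℝ),
      gaussDensityB d L W E p.1 p.2 * Rfun d L W E p.1 p.2 * (p.1 j : ℂ)
    change I 0 = (Bmat d L W E *ᵥ (BmatInv d L W E *ᵥ I)) 0
    rw [Matrix.mulVec_mulVec, Bmat, Matrix.nonsing_inv_mul _ hu, Matrix.one_mulVec]
  · have hg : ∀ a b, gaussDensityB d L W E a b = 0 := by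
      intro a b
      rw [isUnit_iff_ne_zero, not_not] at hu
      simp [gaussDensityB, hu]
    simp [hg]

end
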